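/- arXiv:math/0301128 — 4 statements merged into one kernel-verified Lean document; each statement's English description precedes it below -/
import Mathlib

section
/- For every field k, every n ≥ 1 and every dimension vector d = (d_1,…,d_n) ∈ ℕ^n, the action of the group G_d = ∏_{i=1}^n GL_{d_i}(k) on the representation space E(d) = ⊕_{i=1}^{n−1} Hom_k(k^{d_i}, k^{d_{i+1}}) given by (g·φ)_i = g_{i+1} ∘ φ_i ∘ g_i^{−1} has only finitely many orbits. -/
open Module LinearMap Finset

/-- Two points `φ, ψ` of the representation space
`E(d) = ⊕ᵢ Hom(k^{dᵢ}, k^{dᵢ₊₁})` of the equioriented quiver of type `A`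
lie in the same orbit of `G_d = ∏ᵢ GL_{dᵢ}(k)`, acting by
`(g·φ)ᵢ = gᵢ₊₁ ∘ φᵢ ∘ gᵢ⁻¹`.  (The dimension vector is padded by zeros
outside the vertex range, so that the data is exactly that of `E(d)`.) -/
def sameOrbitA (k : Type*) [Field k] (d : ℕ → ℕ)
    (φ ψ : ∀ i : ℕ, (Fin (d i) → k) →ₗ[k] (Fin (d (i + 1)) → k)) : Prop :=
  ∃ g : ∀ i : ℕ, (Fin (d i) → k) ≃ₗ[k] (Fin (d i) → k),
    ∀ i, ψ i = (g (i + 1)).toLinearMap ∘ₗ φ i ∘ₗ ((g i).symm).toLinearMap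

/-- A linearly independent set `S` compatible with an exhaustive filtration `F` extends to a basis
which is adapted to `F`. -/
theorem exists_adapted_extension {k V : Type*} [Field k] [AddCommGroup V] [Module k V]
    (F : ℕ → Submodule k V) (hF : Monotone F) (h0 : F 0 = ⊥) {m : ℕ} (hm : F m = ⊤)
    {S : Set V} (hS : LinearIndepOn k id S)
    (hSF : ∀ j, Submodule.span k S ⊓ F j ≤ Submodule.span k (S ∩ F j)) :
    ∃ B : Set V, S ⊆ B ∧ LinearIndepOn k id B ∧ ∀ j, F j ≤ Submodule.span k (B ∩ F j) := by
  have key : ∀ r : ℕ, ∃ B : Set V, S ∩ F r ⊆ B ∧ LinearIndepOn k id B ∧ B ⊆ F r ∧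
      ∀ j ≤ r, F j ≤ Submodule.span k (B ∩ F j) := by
    intro r
    induction r with
    | zero =>
      refine ⟨∅, ?_, linearIndepOn_empty _ _, Set.empty_subset _, ?_⟩
      · rintro x ⟨hx, hx0⟩
        rw [h0] at hx0
        have : x = 0 := by simpa using hx0
        exact absurd this (hS.ne_zero hx)
      · intro j hj
        obtain rfl : j = 0 := by omega
        simp [h0]
    | succ r ih =>
      obtain ⟨B, hSB, hB, hBF, hBs⟩ := ih
      have hdisj : Disjoint (Submodule.span k B) (Submodule.span k ((S ∩ F (r + 1)) \ F r)) := by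
        rw [Submodule.disjoint_def]
        intro x hxB hxS
        have hxF : x ∈ F r := Submodule.span_le.2 hBF hxB
        have hx1 : x ∈ Submodule.span k (S ∩ F r) :=
          hSF r ⟨Submodule.span_mono (fun y hy => hy.1.1) hxS, hxF⟩
        have hd : Disjoint (Submodule.span k (id '' (S ∩ F r : Set V)))
            (Submodule.span k (id '' ((S ∩ F (r + 1)) \ F r : Set V))) := by
          have hu : LinearIndepOn k id ((S ∩ F r : Set V) ∪ ((S ∩ F (r + 1)) \ F r : Set V)) :=
            hS.mono (by rintro y (hy | hy); exacts [hy.1, hy.1.1])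
          refine ((linearIndepOn_union_iff ?_).1 hu).2.2
          exact Set.disjoint_left.2 fun y hy hy' => hy'.2 hy.2
        rw [Set.image_id, Set.image_id] at hd
        exact Submodule.disjoint_def.1 hd x hx1 hxS
      have hli : LinearIndepOn k id (B ∪ ((S ∩ F (r + 1)) \ F r : Set V)) :=
        hB.id_union (hS.mono fun y hy => hy.1.1) hdisj
      have hsub : B ∪ ((S ∩ F (r + 1)) \ F r : Set V) ⊆ F (r + 1) := by
        rintro y (hy | hy)
        exacts [hF (Nat.le_succ r) (hBF hy), hy.1.2]
      obtain ⟨C, hCF, hBC, hFC, hC⟩ := exists_linearIndepOn_id_extension hli hsub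
      refine ⟨C, ?_, hC, hCF, ?_⟩
      · rintro y ⟨hyS, hyF⟩
        by_cases hy : y ∈ F r
        · exact hBC (Or.inl (hSB ⟨hyS, hy⟩))
        · exact hBC (Or.inr ⟨⟨hyS, hyF⟩, hy⟩)
      · intro j hj
        rcases Nat.le_succ_iff.1 hj with hj | rfl
        · exact (hBs j hj).trans
            (Submodule.span_mono fun y hy => ⟨hBC (Or.inl hy.1), hy.2⟩)
        · rw [Set.inter_eq_left.2 hCF]
          exact hFC
  obtain ⟨B, hSB, hB, -, hBs⟩ := key m
  refine ⟨B, fun x hx => hSB ⟨hx, by simp [hm]⟩, hB, fun j => ?_⟩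
  rcases le_total j m with hj | hj
  · exact hBs j hj
  · have hj' : F j = ⊤ := top_le_iff.1 (hm ▸ hF hj)
    have := hBs m le_rfl
    rwa [hm, ← hj'] at this

/-- If `B` is a basis of `V` adapted to the kernel of `f` and to the preimages of the filtration
`G`, then the nonzero elements of `f '' B` are linearly independent and compatible with `G`. -/
theorem linearIndepOn_image_sdiff_ker {k V W : Type*} [Field k] [AddCommGroup V] [Module k V]
    [AddCommGroup W] [Module k W] (f : V →ₗ[k] W) (G : ℕ → Submodule k W) (h0 : G 0 = ⊥)
    {B : Set V} (hB : LinearIndepOn k id B)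
    (hBF : ∀ j, (G j).comap f ≤ Submodule.span k (B ∩ (G j).comap f)) :
    LinearIndepOn k id (f '' (B \ LinearMap.ker f)) ∧
      ∀ j, Submodule.span k (f '' (B \ LinearMap.ker f)) ⊓ G j ≤
        Submodule.span k (f '' (B \ LinearMap.ker f) ∩ G j) := by
  constructor
  · have hker : LinearMap.ker f ≤ Submodule.span k (B ∩ LinearMap.ker f) := by
      have := hBF 0
      rwa [h0, Submodule.comap_bot] at this
    have hd : Disjoint (Submodule.span k (id '' (B \ LinearMap.ker f : Set V)))
        (Submodule.span k (id '' (B ∩ LinearMap.ker f : Set V))) := by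
      have hu : LinearIndepOn k id ((B \ LinearMap.ker f : Set V) ∪ (B ∩ LinearMap.ker f)) :=
        hB.mono (by rintro y (hy | hy); exacts [hy.1, hy.1])
      refine ((linearIndepOn_union_iff ?_).1 hu).2.2
      exact Set.disjoint_left.2 fun y hy hy' => hy.2 hy'.2
    rw [Set.image_id, Set.image_id] at hd
    have hli : LinearIndepOn k id (B \ LinearMap.ker f : Set V) := hB.mono Set.sdiff_subset
    refine LinearIndepOn.id_image (hli.map_injOn f ?_)
    rw [Set.image_id]
    exact LinearMap.injOn_of_disjoint_ker le_rfl (hd.mono_right hker)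
  · rintro j x ⟨hx, hxG⟩
    obtain ⟨y, hy, rfl⟩ : x ∈ (Submodule.span k (B \ LinearMap.ker f : Set V)).map f := by
      rwa [Submodule.map_span]
    have hy' : f y ∈ (Submodule.span k (B ∩ (G j).comap f : Set V)).map f :=
      Submodule.mem_map_of_mem (hBF j hxG)
    rw [Submodule.map_span] at hy'
    refine Submodule.span_le.2 ?_ hy'
    rintro _ ⟨z, ⟨hzB, hzG⟩, rfl⟩
    by_cases hz : f z = 0
    · simp [hz]
    · exact Submodule.subset_span ⟨⟨z, ⟨hzB, hz⟩, rfl⟩, hzG⟩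

/-- The kernel of the composite `V i → V (i + j)` in a sequence of linear maps. -/
def compKer {k : Type*} [Field k] {V : ℕ → Type*} [∀ i, AddCommGroup (V i)]
    [∀ i, Module k (V i)] (φ : ∀ i, V i →ₗ[k] V (i + 1)) : ℕ → ∀ i, Submodule k (V i)
  | 0, _ => ⊥
  | j + 1, i => (compKer φ j (i + 1)).comap (φ i)

section

variable {k : Type*} [Field k] {V : ℕ → Type*} [∀ i, AddCommGroup (V i)]
  [∀ i, Module k (V i)] (φ : ∀ i, V i →ₗ[k] V (i + 1))

theorem compKer_monotone (i : ℕ) : Monotone fun j => compKer φ j i := by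
  refine monotone_nat_of_le_succ fun j => ?_
  induction j generalizing i with
  | zero => exact bot_le
  | succ j ih => exact Submodule.comap_mono (ih (i + 1))

theorem compKer_eq_top {m : ℕ} (hm : ∀ j, m ≤ j → Subsingleton (V j)) (j i : ℕ)
    (hij : m ≤ i + j) : compKer φ j i = ⊤ := by
  induction j generalizing i with
  | zero =>
    have := hm i hij
    exact Subsingleton.elim _ _
  | succ j ih => rw [compKer, ih (i + 1) (by omega), Submodule.comap_top]

/-- A bounded-on-the-right sequence of linear maps admits bases in which every map sends each basis
vector to zero or to a basis vector. -/
theorem exists_compatible_bases {m : ℕ} (hm : ∀ j, m ≤ j → Subsingleton (V j)) :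
    ∃ B : ∀ i, Set (V i), (∀ i, LinearIndepOn k id (B i)) ∧
      (∀ i, ⊤ ≤ Submodule.span k (B i)) ∧
      ∀ i, ∀ x ∈ B i, φ i x = 0 ∨ φ i x ∈ B (i + 1) := by
  have htop : ∀ i, compKer φ m i = ⊤ := fun i => compKer_eq_top φ hm m i (by omega)
  let P : ∀ i, Set (V i) → Prop := fun i B => LinearIndepOn k id B ∧
    ∀ j, compKer φ j i ≤ Submodule.span k (B ∩ compKer φ j i)
  have base : ∃ B, P 0 B := by
    obtain ⟨B, -, hB⟩ := exists_adapted_extension (fun j => compKer φ j 0) (compKer_monotone φ 0)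
      rfl (htop 0) (linearIndepOn_empty k id) (by simp)
    exact ⟨B, hB⟩
  have step : ∀ i (B : {B // P i B}), ∃ C : {C // P (i + 1) C},
      ∀ x ∈ B.1, φ i x = 0 ∨ φ i x ∈ C.1 := by
    rintro i ⟨B, hB, hBF⟩
    obtain ⟨h1, h2⟩ := linearIndepOn_image_sdiff_ker (φ i) (fun j => compKer φ j (i + 1)) rfl hB
      fun j => hBF (j + 1)
    obtain ⟨C, hSC, hC⟩ := exists_adapted_extension (fun j => compKer φ j (i + 1))
      (compKer_monotone φ (i + 1)) rfl (htop (i + 1)) h1 h2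
    exact ⟨⟨C, hC⟩, fun x hx => or_iff_not_imp_left.2 fun h => hSC ⟨x, ⟨hx, h⟩, rfl⟩⟩
  obtain ⟨B₀, hB₀⟩ := base
  choose next hnext using step
  let B : ∀ i, {B // P i B} := fun i => Nat.rec ⟨B₀, hB₀⟩ (fun i B => next i B) i
  refine ⟨fun i => (B i).1, fun i => (B i).2.1, fun i => ?_, fun i => hnext i (B i)⟩
  have h := (B i).2.2 m
  rw [htop i] at h
  exact h.trans (Submodule.span_mono Set.inter_subset_left)

end

/-- The representation whose maps send the standard basis vectors to zero or to standard basis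
vectors, as prescribed by `f` at the vertices below `m`, and which vanishes beyond. -/
noncomputable def zeroOneRep (k : Type*) [Field k] (d : ℕ → ℕ) (m : ℕ)
    (f : ∀ i : Fin m, Fin (d i) → Option (Fin (d (i + 1)))) (i : ℕ) :
    (Fin (d i) → k) →ₗ[k] (Fin (d (i + 1)) → k) :=
  if h : i < m then
    (Pi.basisFun k (Fin (d i))).constr k fun a => (f ⟨i, h⟩ a).elim 0 fun b => Pi.single b 1
  else 0

/-- For every field `k`, every `n ≥ 1` and every dimension vector
`d = (d_1, …, d_n)`, the group `G_d = ∏ᵢ GL_{dᵢ}(k)` acts on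
`E(d) = ⊕_{i=1}^{n-1} Hom(k^{dᵢ}, k^{dᵢ₊₁})` with only finitely many orbits. -/
theorem finitely_many_orbits_type_A
    (k : Type*) [Field k] (n : ℕ) (hn : 1 ≤ n) (d : ℕ → ℕ)
    (hd0 : d 0 = 0) (hdn : ∀ j, n < j → d j = 0) :
    ∃ s : Set (∀ i : ℕ, (Fin (d i) → k) →ₗ[k] (Fin (d (i + 1)) → k)),
      s.Finite ∧ ∀ φ, ∃ ψ ∈ s, sameOrbitA k d φ ψ := by
  refine ⟨Set.range (zeroOneRep k d (n + 1)), Set.finite_range _, fun φ => ?_⟩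
  obtain ⟨B, hB, hBs, hBφ⟩ := exists_compatible_bases φ (m := n + 1) fun j hj => by
    have : IsEmpty (Fin (d j)) := by rw [hdn j hj]; infer_instance
    infer_instance
  have hbasis : ∀ i, ∃ e : Basis (Fin (d i)) k (Fin (d i) → k), Set.range e = B i := by
    intro i
    let b : Basis (B i) k (Fin (d i) → k) := Basis.mk (hB i) (by simpa using hBs i)
    refine ⟨b.reindex (b.indexEquiv (Pi.basisFun k (Fin (d i)))), ?_⟩
    simp [b]
  choose e he using hbasis
  have hf : ∀ i a, ∃ o : Option (Fin (d (i + 1))), φ i (e i a) = o.elim 0 (e (i + 1)) := by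
    intro i a
    rcases hBφ i (e i a) (he i ▸ Set.mem_range_self a) with h | h
    · exact ⟨none, h⟩
    · rw [← he (i + 1)] at h
      obtain ⟨b, hb⟩ := h
      exact ⟨some b, hb.symm⟩
  choose f hf using hf
  refine ⟨_, ⟨fun i => f i, rfl⟩, fun i => (e i).equivFun, fun i => ?_⟩
  refine (Pi.basisFun k (Fin (d i))).ext fun a => ?_
  have hi : i < n + 1 := by
    by_contra h
    have := a.pos
    have := hdn i (by omega)
    omega
  have hea : (e i).equivFun.symm (Pi.single a 1) = e i a := by
    rw [LinearEquiv.symm_apply_eq]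
    ext b
    simp [Pi.single_apply, eq_comm]
  rw [zeroOneRep, dif_pos hi, Basis.constr_basis]
  simp only [LinearMap.comp_apply, LinearEquiv.coe_coe, Pi.basisFun_apply, hea, hf]
  cases f i a with
  | none => simp
  | some b =>
    ext c
    simp [Pi.single_apply, eq_comm]
end

section
/- For every dimension vector d = (d_1,…,d_n) ∈ ℕ^n there exists a representation φ ∈ E(d) of Δ_n such that rank(φ_j ∘ ⋯ ∘ φ_i) = min(d_i, d_{i+1}, …, d_{j+1}) for all 1 ≤ i ≤ j ≤ n−1; moreover, every ψ ∈ E(d) satisfies rank(ψ_j ∘ ⋯ ∘ ψ_i) ≤ min(d_i, d_{i+1}, …, d_{j+1}) for all 1 ≤ i ≤ j ≤ n−1. (This φ is the generic representation of dimension d, whose G_d-orbit is dense in E(d).) -/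
open Module LinearMap Finset

/-- The composition `φ_{i+t-1} ∘ ⋯ ∘ φ_{i+1} ∘ φ_i` of `t` consecutive structure
maps of a representation of an equioriented quiver of type `A`, starting at
vertex `i`. -/
def comps {k : Type*} [Field k] {V : ℕ → Type*}
    [∀ i, AddCommGroup (V i)] [∀ i, Module k (V i)]
    (φ : ∀ i : ℕ, V i →ₗ[k] V (i + 1)) (i : ℕ) : ∀ t : ℕ, V i →ₗ[k] V (i + t)
  | 0 => LinearMap.id
  | t + 1 => (φ (i + t)).comp (comps φ i t)

/-- A composition of consecutive structure maps has rank at most the dimension of every space it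
passes through. -/
theorem finrank_range_comps_le {k : Type*} [Field k] {V : ℕ → Type*}
    [∀ i, AddCommGroup (V i)] [∀ i, Module k (V i)] [∀ i, FiniteDimensional k (V i)]
    (ψ : ∀ i : ℕ, V i →ₗ[k] V (i + 1)) (i : ℕ) {s t : ℕ} (hst : s ≤ t) :
    finrank k (LinearMap.range (comps ψ i t)) ≤ finrank k (V (i + s)) := by
  induction t with
  | zero =>
    obtain rfl : s = 0 := by omega
    exact Submodule.finrank_le _
  | succ t ih =>
    rcases Nat.of_le_succ hst with h | rfl
    · have hr : LinearMap.range (comps ψ i (t + 1)) =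
          (LinearMap.range (comps ψ i t)).map (ψ (i + t)) := LinearMap.range_comp _ _
      rw [hr]
      exact (Submodule.finrank_map_le _ _).trans (ih h)
    · exact Submodule.finrank_le _

/-- The linear map `k ^ a → k ^ b` keeping the first `min a b` coordinates and filling up with
zeros. -/
def truncateOrPad (k : Type*) [Field k] (a b : ℕ) : (Fin a → k) →ₗ[k] (Fin b → k) where
  toFun v m := if h : (m : ℕ) < a then v ⟨m, h⟩ else 0
  map_add' v w := by
    ext m
    by_cases h : (m : ℕ) < a <;> simp [h]
  map_smul' c v := by
    ext m
    by_cases h : (m : ℕ) < a <;> simp [h]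

theorem truncateOrPad_apply_of_lt {k : Type*} [Field k] {a b : ℕ} (v : Fin a → k) (m : Fin b)
    (h : (m : ℕ) < a) : truncateOrPad k a b v m = v ⟨m, h⟩ :=
  dif_pos h

theorem comps_truncateOrPad_apply {k : Type*} [Field k] (d : ℕ → ℕ) (i t m : ℕ)
    (h : ∀ s ≤ t, m < d (i + s)) (v : Fin (d i) → k) :
    comps (V := fun i => Fin (d i) → k) (fun i => truncateOrPad k (d i) (d (i + 1))) i t v
      ⟨m, h t le_rfl⟩ = v ⟨m, h 0 (Nat.zero_le t)⟩ := by
  induction t with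
  | zero => rfl
  | succ t ih =>
    have ht : ∀ s ≤ t, m < d (i + s) := fun s hs => h s (hs.trans t.le_succ)
    exact (truncateOrPad_apply_of_lt _ _ (ht t le_rfl)).trans (ih ht)

theorem le_finrank_range_comps_truncateOrPad (k : Type*) [Field k] (d : ℕ → ℕ) (i t r : ℕ)
    (h : ∀ s ≤ t, r ≤ d (i + s)) :
    r ≤ finrank k (LinearMap.range (comps (V := fun i => Fin (d i) → k)
      (fun i => truncateOrPad k (d i) (d (i + 1))) i t)) := by
  set f := comps (V := fun i => Fin (d i) → k)
    (fun i => truncateOrPad k (d i) (d (i + 1))) i t with hf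
  let p : (Fin (d (i + t)) → k) →ₗ[k] (Fin r → k) :=
    LinearMap.funLeft k k (Fin.castLE (h t le_rfl))
  have hsurj : LinearMap.range (p.comp f) = ⊤ := by
    refine LinearMap.range_eq_top.mpr fun w => ⟨truncateOrPad k r (d i) w, ?_⟩
    ext m
    have hm : ∀ s ≤ t, (m : ℕ) < d (i + s) := fun s hs => m.isLt.trans_le (h s hs)
    exact (comps_truncateOrPad_apply d i t m hm _).trans (truncateOrPad_apply_of_lt w _ m.isLt)
  calc r = finrank k (LinearMap.range (p.comp f)) := by
        rw [hsurj, finrank_top, finrank_fin_fun]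
    _ = finrank k ((LinearMap.range f).map p) := by rw [LinearMap.range_comp]
    _ ≤ finrank k (LinearMap.range f) := Submodule.finrank_map_le _ _

/-- For every dimension vector `d` there is a (generic) representation
`φ ∈ E(d)` of the equioriented quiver `Δ_n` with
`rank(φ_j ∘ ⋯ ∘ φ_i) = min(d_i, …, d_{j+1})` for all `1 ≤ i ≤ j ≤ n-1`;
moreover every `ψ ∈ E(d)` satisfies
`rank(ψ_j ∘ ⋯ ∘ ψ_i) ≤ min(d_i, …, d_{j+1})`. -/
theorem generic_representation_type_A
    (k : Type*) [Field k] (n : ℕ) (hn : 1 ≤ n) (d : ℕ → ℕ)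
    (hd0 : d 0 = 0) (hdn : ∀ j, n < j → d j = 0) :
    (∃ φ : ∀ i : ℕ, (Fin (d i) → k) →ₗ[k] (Fin (d (i + 1)) → k),
      ∀ i j : ℕ, (hi : 1 ≤ i) → (hij : i ≤ j) → (hj : j ≤ n - 1) →
        finrank k (LinearMap.range (comps φ i (j - i + 1)))
          = (Finset.Icc i (j + 1)).inf'
              (Finset.nonempty_Icc.mpr (by omega)) d) ∧
    ∀ ψ : ∀ i : ℕ, (Fin (d i) → k) →ₗ[k] (Fin (d (i + 1)) → k),
      ∀ i j : ℕ, (hi : 1 ≤ i) → (hij : i ≤ j) → (hj : j ≤ n - 1) →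
        finrank k (LinearMap.range (comps ψ i (j - i + 1)))
          ≤ (Finset.Icc i (j + 1)).inf'
              (Finset.nonempty_Icc.mpr (by omega)) d := by
  have upper : ∀ ψ : ∀ i : ℕ, (Fin (d i) → k) →ₗ[k] (Fin (d (i + 1)) → k),
      ∀ i j : ℕ, (hij : i ≤ j) →
        finrank k (LinearMap.range (comps ψ i (j - i + 1)))
          ≤ (Finset.Icc i (j + 1)).inf'
              (Finset.nonempty_Icc.mpr (by omega)) d := by
    intro ψ i j hij
    refine Finset.le_inf' _ _ fun l hl => ?_
    rw [Finset.mem_Icc] at hl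
    have hle := finrank_range_comps_le ψ i (s := l - i) (t := j - i + 1) (by omega)
    rwa [finrank_fin_fun, Nat.add_sub_cancel' hl.1] at hle
  refine ⟨⟨fun i => truncateOrPad k (d i) (d (i + 1)), fun i j _ hij _ =>
    le_antisymm (upper _ i j hij) ?_⟩, fun ψ i j _ hij _ => upper ψ i j hij⟩
  refine le_finrank_range_comps_truncateOrPad k d i (j - i + 1) _ fun s hs => ?_
  exact Finset.inf'_le d (Finset.mem_Icc.mpr ⟨by omega, by omega⟩)
end

section
/- Let k be a field, V a finite-dimensional k-vector space, x a nilpotent endomorphism of V with x^r = 0, and set d_t = dim ker(x^t) − dim ker(x^{t−1}) for t = 1,…,r. If 0 = L_0 ⊆ L_1 ⊆ ⋯ ⊆ L_r = V is a chain of subspaces with x(L_t) ⊆ L_{t−1} and dim L_t − dim L_{t−1} = d_t for all t, then L_t = ker(x^t) for every t. In particular, a nilpotent endomorphism admits exactly one flag compatible with x whose successive dimension jumps are (d_1,…,d_r). -/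
open Module LinearMap Finset

/-- Let `x` be a nilpotent endomorphism of a finite-dimensional vector space `V`
with `x^r = 0`, and set `d_t = dim ker(x^t) − dim ker(x^{t-1})`.  If
`0 = L_0 ⊆ L_1 ⊆ ⋯ ⊆ L_r = V` is a chain of subspaces with `x(L_t) ⊆ L_{t-1}`
and `dim L_t − dim L_{t-1} = d_t` for all `t`, then `L_t = ker(x^t)` for all
`t ≤ r`.  In particular, `x` admits exactly one compatible flag with these
dimension jumps. -/
theorem unique_compatible_flag_for_nilpotent
    (k : Type*) [Field k] (V : Type*) [AddCommGroup V] [Module k V]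
    [FiniteDimensional k V]
    (x : Module.End k V) (r : ℕ) (hx : x ^ r = 0)
    (L : ℕ → Submodule k V)
    (hL0 : L 0 = ⊥) (hLr : L r = ⊤)
    (hmono : ∀ t, t < r → L t ≤ L (t + 1))
    (hcomp : ∀ t, 1 ≤ t → t ≤ r → (L t).map x ≤ L (t - 1))
    (hdim : ∀ t, 1 ≤ t → t ≤ r →
      finrank k (L t) = finrank k (L (t - 1)) +
        (finrank k (LinearMap.ker (x ^ t)) - finrank k (LinearMap.ker (x ^ (t - 1))))) :
    ∀ t ≤ r, L t = LinearMap.ker (x ^ t) := by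
  intro t ht
  induction t with
  | zero => simp [hL0, Module.End.one_eq_id]
  | succ t ih =>
    have ih := ih (by omega)
    have hker : LinearMap.ker (x ^ t) ≤ LinearMap.ker (x ^ (t + 1)) := by
      rw [pow_succ']
      exact LinearMap.ker_le_ker_comp _ _
    have hle : L (t + 1) ≤ LinearMap.ker (x ^ (t + 1)) := by
      intro v hv
      have hxv : x v ∈ L t := hcomp (t + 1) (by omega) ht (Submodule.mem_map_of_mem hv)
      rw [ih, LinearMap.mem_ker] at hxv
      rwa [LinearMap.mem_ker, pow_succ, Module.End.mul_apply]
    refine Submodule.eq_of_le_of_finrank_eq hle ?_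
    have hd := hdim (t + 1) (by omega) ht
    rw [Nat.add_sub_cancel, ih] at hd
    rw [hd, Nat.add_sub_cancel' (Submodule.finrank_mono hker)]
end

section
/- Let k be a field, n ≥ 1, d = (d_1,…,d_n) ∈ ℕ^n, and let d^{(1)},…,d^{(r)} ∈ ℕ^n be dimension vectors with Σ_t d^{(t)} = d. Fix a flag 0 = L_0 ⊆ L_1 ⊆ ⋯ ⊆ L_r = ⊕_{i=1}^n k^{d_i} of graded subspaces L_t = ⊕_{i=1}^n (L_t)_i ⊆ ⊕_i k^{d_i} with dim (L_t)_i − dim (L_{t−1})_i = d^{(t)}_i for all i, t. Then the set { (φ_i)_{i=1}^{n−1} ∈ E(d) : φ_i((L_t)_i) ⊆ (L_{t−1})_{i+1} for all i, t } is a k-linear subspace of E(d) of dimension Σ_{i=1}^n Σ_{1 ≤ s < t ≤ r} d^{(s)}_i · d^{(t)}_{i−1}, where d^{(t)}_0 := 0. (So X_{\underline{d}} is a vector bundle over the graded flag variety of this rank.) -/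
open Module LinearMap Finset

/-- The linear maps `φ` with `φ (W (t + 1)) ⊆ W' t` for all `t < r`. -/
def flagLoweringMaps {k V V' : Type*} [Field k] [AddCommGroup V] [Module k V]
    [AddCommGroup V'] [Module k V'] (W : ℕ → Submodule k V) (W' : ℕ → Submodule k V')
    (r : ℕ) : Submodule k (V →ₗ[k] V') where
  carrier := {φ | ∀ t < r, ∀ x ∈ W (t + 1), φ x ∈ W' t}
  add_mem' hφ hψ t ht x hx := (W' t).add_mem (hφ t ht x hx) (hψ t ht x hx)
  zero_mem' t _ _ _ := (W' t).zero_mem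
  smul_mem' c _ hφ t ht x hx := (W' t).smul_mem c (hφ t ht x hx)

section FlagLoweringMaps

variable {k V V' : Type*} [Field k] [AddCommGroup V] [Module k V]
  [AddCommGroup V'] [Module k V'] {W : ℕ → Submodule k V} {W' : ℕ → Submodule k V'} {r : ℕ}

theorem mem_flagLoweringMaps {φ : V →ₗ[k] V'} :
    φ ∈ flagLoweringMaps W W' r ↔ ∀ t < r, ∀ x ∈ W (t + 1), φ x ∈ W' t :=
  Iff.rfl

theorem le_of_step_le {α : Type*} [Preorder α] {f : ℕ → α} {r : ℕ}
    (hf : ∀ t < r, f t ≤ f (t + 1)) {s t : ℕ} (hst : s ≤ t) (ht : t ≤ r) : f s ≤ f t := by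
  induction t, hst using Nat.le_induction with
  | base => exact le_rfl
  | succ t _ ih => exact (ih (by lia)).trans (hf t (by lia))

/-- Flag-lowering maps send `W r` into `W' r`. -/
theorem apply_mem_of_mem_flagLoweringMaps (hW0 : W 0 = ⊥) (hW' : ∀ t < r, W' t ≤ W' (t + 1))
    {φ : V →ₗ[k] V'} (hφ : φ ∈ flagLoweringMaps W W' r) {x : V} (hx : x ∈ W r) :
    φ x ∈ W' r := by
  cases r with
  | zero => simp_all
  | succ r => exact hW' r (by lia) (hφ r (by lia) x hx)

/-- Lowering the flag one step further costs `dim (W (r + 1) / W r) * dim (V' / W' r)`. -/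
theorem finrank_flagLoweringMaps_succ [FiniteDimensional k V] [FiniteDimensional k V']
    (hW0 : W 0 = ⊥) (hW : ∀ t < r + 1, W t ≤ W (t + 1)) (hW' : ∀ t < r, W' t ≤ W' (t + 1))
    {j : ℕ} (hj : finrank k (W (r + 1)) = finrank k (W r) + j) :
    finrank k (flagLoweringMaps W W' (r + 1)) + j * finrank k (V' ⧸ W' r) =
      finrank k (flagLoweringMaps W W' r) := by
  obtain ⟨C, hdisj, hsup⟩ := IsModularLattice.exists_disjoint_and_sup_eq (hW r (by lia))
  obtain ⟨D, hD, hDC⟩ := hdisj.exists_isCompl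
  have hC : finrank k C = j := by
    have h := Submodule.finrank_sup_add_finrank_inf_eq (W r) C
    rw [hsup, hdisj.eq_bot, finrank_bot] at h
    lia
  let f : (V →ₗ[k] V') →ₗ[k] C →ₗ[k] V' ⧸ W' r :=
    (compRight k (W' r).mkQ).comp (lcomp k V' C.subtype)
  let g := f.domRestrict (flagLoweringMaps W W' r)
  have hf (φ : V →ₗ[k] V') : f φ = 0 ↔ ∀ x ∈ C, φ x ∈ W' r := by
    simp [f, LinearMap.ext_iff]
  have hle : flagLoweringMaps W W' (r + 1) ≤ flagLoweringMaps W W' r :=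
    fun φ hφ t ht => hφ t (by lia)
  have hker : ker g = (flagLoweringMaps W W' (r + 1)).submoduleOf (flagLoweringMaps W W' r) := by
    ext ⟨φ, hφ⟩
    change f φ = 0 ↔ φ ∈ flagLoweringMaps W W' (r + 1)
    rw [hf]
    refine ⟨fun h t ht x hx => ?_, fun h x hx => h r (by lia) x (hsup ▸ Submodule.mem_sup_right hx)⟩
    obtain ht | rfl := Nat.lt_succ_iff_lt_or_eq.1 ht
    · exact hφ t ht x hx
    · rw [← hsup] at hx
      obtain ⟨y, hy, z, hz, rfl⟩ := Submodule.mem_sup.1 hx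
      rw [map_add]
      exact (W' t).add_mem (apply_mem_of_mem_flagLoweringMaps hW0 hW' hφ hy) (h z hz)
  have hrange : range g = ⊤ := by
    refine range_eq_top.2 fun ψ => ?_
    obtain ⟨σ, hσ⟩ := (W' r).mkQ.exists_rightInverse_of_surjective (W' r).range_mkQ
    refine ⟨⟨σ ∘ₗ ψ ∘ₗ C.projectionOnto D hDC.symm, fun t ht x hx => ?_⟩, ?_⟩
    · have hxD : x ∈ D := hD (le_of_step_le hW (by lia : t + 1 ≤ r) (by lia) hx)
      simp [(Submodule.projectionOnto_apply_eq_zero_iff hDC.symm).2 hxD]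
    · ext x
      have := LinearMap.congr_fun hσ (ψ x)
      simpa [g, f] using this
  have h := g.finrank_range_add_finrank_ker
  rw [hrange, finrank_top, finrank_linearMap, hC, hker,
    (Submodule.submoduleOfEquivOfLe hle).finrank_eq] at h
  lia

theorem finrank_flagLoweringMaps_add [FiniteDimensional k V] [FiniteDimensional k V']
    (hW0 : W 0 = ⊥) (hW : ∀ t < r, W t ≤ W (t + 1)) (hW' : ∀ t < r, W' t ≤ W' (t + 1))
    {j : ℕ → ℕ} (hj : ∀ t < r, finrank k (W (t + 1)) = finrank k (W t) + j t) :
    finrank k (flagLoweringMaps W W' r) + ∑ t ∈ range r, j t * finrank k (V' ⧸ W' t) =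
      finrank k V * finrank k V' := by
  induction r with
  | zero =>
    have h : flagLoweringMaps W W' 0 = ⊤ := eq_top_iff.2 fun _ _ t ht => absurd ht t.not_lt_zero
    rw [h, finrank_top, finrank_linearMap, range_zero, sum_empty, add_zero]
  | succ r ih =>
    rw [← ih (fun t ht => hW t (by lia)) (fun t ht => hW' t (by lia)) (fun t ht => hj t (by lia)),
      ← finrank_flagLoweringMaps_succ hW0 hW (fun t ht => hW' t (by lia)) (hj r (by lia)),
      sum_range_succ]
    ring

theorem finrank_eq_sum_of_step (hW0 : W 0 = ⊥) {j : ℕ → ℕ}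
    (hj : ∀ t < r, finrank k (W (t + 1)) = finrank k (W t) + j t) {t : ℕ} (ht : t ≤ r) :
    finrank k (W t) = ∑ s ∈ range t, j s := by
  induction t with
  | zero => rw [hW0, finrank_bot, range_zero, sum_empty]
  | succ t ih => rw [hj t (by lia), ih (by lia), sum_range_succ]

/-- The dimension of the space of maps lowering a full filtration of `V`. -/
theorem finrank_flagLoweringMaps [FiniteDimensional k V] [FiniteDimensional k V']
    (hW0 : W 0 = ⊥) (hWr : W r = ⊤) (hW : ∀ t < r, W t ≤ W (t + 1))
    (hW' : ∀ t < r, W' t ≤ W' (t + 1))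
    {j : ℕ → ℕ} (hj : ∀ t < r, finrank k (W (t + 1)) = finrank k (W t) + j t) :
    finrank k (flagLoweringMaps W W' r) = ∑ t ∈ range r, j t * finrank k (W' t) := by
  have hV : finrank k V = ∑ t ∈ range r, j t := by
    rw [← finrank_eq_sum_of_step hW0 hj le_rfl, hWr, finrank_top]
  have h := finrank_flagLoweringMaps_add hW0 hW hW' hj
  have h' : ∑ t ∈ range r, j t * finrank k (W' t) + ∑ t ∈ range r, j t * finrank k (V' ⧸ W' t) =
      finrank k V * finrank k V' := by
    rw [← sum_add_distrib, hV, sum_mul]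
    refine sum_congr rfl fun t _ => ?_
    rw [← (W' t).finrank_quotient_add_finrank]
    ring
  lia

end FlagLoweringMaps

/-- A product of submodules, only finitely many of whose factors live in nonzero modules, has
the expected dimension. -/
theorem finrank_pi_nat_of_subsingleton {k : Type*} [Field k] {M : ℕ → Type*}
    [∀ i, AddCommGroup (M i)] [∀ i, Module k (M i)] [∀ i, FiniteDimensional k (M i)]
    (S : ∀ i, Submodule k (M i)) (n : ℕ) (hM : ∀ i, n ≤ i → Subsingleton (M i)) :
    finrank k (Submodule.pi Set.univ S) = ∑ i ∈ range n, finrank k (S i) := by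
  let f : Submodule.pi Set.univ S →ₗ[k] ∀ i : Fin n, S i :=
    LinearMap.pi fun i =>
      ((LinearMap.proj (i : ℕ)).comp (Submodule.subtype _)).codRestrict (S i)
        fun x => x.2 i trivial
  have hf : Function.Bijective f := by
    refine ⟨fun x y hxy => ?_, fun y => ?_⟩
    · ext i
      by_cases hi : i < n
      · exact congrArg Subtype.val (congrFun hxy ⟨i, hi⟩)
      · exact (hM i (not_lt.1 hi)).elim _ _
    · refine ⟨⟨fun i => if hi : i < n then y ⟨i, hi⟩ else 0, fun i _ => ?_⟩, ?_⟩
      · by_cases hi : i < n <;> simp [hi]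
      · ext i
        exact dif_pos i.2
  rw [(LinearEquiv.ofBijective f hf).finrank_eq, finrank_pi_fintype,
    Fin.sum_univ_eq_sum_range fun i => finrank k (S i)]

/-- Fix a graded flag `0 = L_0 ⊆ ⋯ ⊆ L_r = ⊕ᵢ k^{dᵢ}` of `I`-graded subspaces
`(W t i ⊆ k^{dᵢ})` with graded dimension jumps `d^{(t)}`.  Then the set of
representations `φ ∈ E(d)` of the equioriented quiver `Δ_n` with
`φᵢ((L_t)ᵢ) ⊆ (L_{t-1})_{i+1}` for all `i, t` (the fiber of
`X_{\underline d} → F_{\underline d}` over the flag) is a `k`-linear subspace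
of `E(d)` of dimension `Σᵢ Σ_{s<t} d^{(s)}ᵢ · d^{(t)}_{i-1}`.
(Dimension vectors are padded by zeros outside the vertex range `1, …, n`,
so that `d^{(t)}_0 = 0`.) -/
theorem fiber_of_quiver_flag_bundle_is_linear_of_known_dimension
    (k : Type*) [Field k] (n : ℕ) (hn : 1 ≤ n) (r : ℕ)
    (d : ℕ → ℕ) (hd0 : d 0 = 0) (hdn : ∀ j, n < j → d j = 0)
    (dvec : ℕ → ℕ → ℕ)
    (hdvec0 : ∀ t, dvec t 0 = 0) (hdvecn : ∀ t j, n < j → dvec t j = 0)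
    (hsum : ∀ i, ∑ t ∈ Icc 1 r, dvec t i = d i)
    (W : ℕ → ∀ i : ℕ, Submodule k (Fin (d i) → k))
    (hW0 : ∀ i, W 0 i = ⊥) (hWr : ∀ i, W r i = ⊤)
    (hWmono : ∀ t, 1 ≤ t → t ≤ r → ∀ i, W (t - 1) i ≤ W t i)
    (hWdim : ∀ t, 1 ≤ t → t ≤ r → ∀ i,
      finrank k (W t i) = finrank k (W (t - 1) i) + dvec t i) :
    ∃ S : Submodule k (∀ i : ℕ, (Fin (d i) → k) →ₗ[k] (Fin (d (i + 1)) → k)),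
      (↑S = {φ : ∀ i : ℕ, (Fin (d i) → k) →ₗ[k] (Fin (d (i + 1)) → k) |
        ∀ t, 1 ≤ t → t ≤ r → ∀ i, (W t i).map (φ i) ≤ W (t - 1) (i + 1)}) ∧
      finrank k S = ∑ i ∈ Icc 1 n, ∑ t ∈ Icc 1 r, ∑ s ∈ Ico 1 t,
        dvec s i * dvec t (i - 1) := by
  have hmono : ∀ i, ∀ t < r, W t i ≤ W (t + 1) i := fun i t ht => hWmono (t + 1) (by lia) ht i
  have hdim : ∀ i, ∀ t < r, finrank k (W (t + 1) i) = finrank k (W t i) + dvec (t + 1) i :=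
    fun i t ht => hWdim (t + 1) (by lia) ht i
  refine ⟨Submodule.pi Set.univ fun i => flagLoweringMaps (W · i) (W · (i + 1)) r, ?_, ?_⟩
  · ext φ
    simp only [SetLike.mem_coe, Submodule.mem_pi, Set.mem_univ, true_imp_iff,
      mem_flagLoweringMaps, Set.mem_ofPred_eq, Submodule.map_le_iff_le_comap]
    refine ⟨fun h t ht htr i x hx => ?_, fun h i t ht x hx => h (t + 1) (by lia) ht i hx⟩
    obtain ⟨t, rfl⟩ := Nat.exists_eq_add_of_le' ht
    exact h i t htr x hx
  · rw [finrank_pi_nat_of_subsingleton _ n fun i hi => ?_]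
    · have hIcc (m : ℕ) (f : ℕ → ℕ) : ∑ i ∈ Icc 1 m, f i = ∑ i ∈ range m, f (i + 1) := by
        rw [range_eq_Ico, sum_Ico_add', zero_add, Ico_add_one_right_eq_Icc]
      rw [hIcc]
      refine sum_congr rfl fun i _ => ?_
      rw [finrank_flagLoweringMaps (hW0 i) (hWr i) (hmono i) (hmono (i + 1)) (hdim i), hIcc]
      refine sum_congr rfl fun t ht => ?_
      rw [finrank_eq_sum_of_step (W := (W · (i + 1))) (hW0 (i + 1)) (hdim (i + 1)) (mem_range.1 ht).le, mul_comm,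
        sum_mul, range_eq_Ico, sum_Ico_add' (fun s => dvec s (i + 1) * dvec (t + 1) i)]
      simp
    · have : IsEmpty (Fin (d (i + 1))) := by
        rw [hdn (i + 1) (by lia)]
        infer_instance
      infer_instance
end
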